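/- Let γ : [0,1] → ℝ² be a C¹ constant speed non-closed planar curve (γ(1) ≠ γ(0)) with γ(0) = (0,0), and θ a turning angle function with θ(0) = 0 and θ(1) − θ(0) = 2mπ for a nonzero integer m. Let k ≥ 3 and σ ∈ S_k. Then there exist cuts C in the interior of D_k (i.e., with 0 < c₁ < c₂ < … < c_{k−1} < 1, so that no arc degenerates) such that e_σ(C) = (0,0), i.e., the rearranged curve r_{σ,C} is a closed C¹ curve, if and only if σ is not a cyclic shift (σ ∈ S_k \ Z_k). -/

import Mathlib

/-- Counterclockwise rotation of the plane (identified with `ℂ`) about the origin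
by angle `α`: `(x,y) ↦ (x cos α − y sin α, x sin α + y cos α)`. -/
noncomputable def rot (α : ℝ) (v : ℂ) : ℂ :=
  ⟨v.re * Real.cos α - v.im * Real.sin α, v.re * Real.sin α + v.im * Real.cos α⟩

/-- A valid vector of cuts `(c₁,…,c_{k−1}) ∈ D_k`, encoded as `c : ℕ → ℝ` with the
conventions `c 0 = 0` and `c k = 1`: `0 = c₀ ≤ c₁ ≤ … ≤ c_{k−1} ≤ c_k = 1`. -/
def IsCuts (k : ℕ) (c : ℕ → ℝ) : Prop :=
  c 0 = 0 ∧ c k = 1 ∧ ∀ i < k, c i ≤ c (i + 1)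

/-- Endpoint `e_σ(C)` of the rearranged curve `r_{σ,C}`: the arcs
`γ|_[c_{i−1}, c_i]` are concatenated in the order `σ(1),…,σ(k)`, matching tangent
directions at the junctions and starting at the origin with initial direction `0`;
`e_σ(C) = Σ_{i=1}^k R_{β_i}(γ(c_{σ(i)}) − γ(c_{σ(i)−1}))` where
`β_i = Σ_{j=1}^{i−1} (θ(c_{σ(j)}) − θ(c_{σ(j)−1})) − θ(c_{σ(i)−1})`. -/
noncomputable def rearrangedEnd (k : ℕ) (γ : ℝ → ℂ) (θ : ℝ → ℝ)
    (σ : ℕ → ℕ) (c : ℕ → ℝ) : ℂ :=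
  ∑ i ∈ Finset.Icc 1 k,
    rot ((∑ j ∈ Finset.Icc 1 (i - 1), (θ (c (σ j)) - θ (c (σ j - 1))))
          - θ (c (σ i - 1)))
      (γ (c (σ i)) - γ (c (σ i - 1)))

/-- `σ` acts on `{1,…,k}` as the cyclic shift `z_h` for some `h ∈ {0,…,k−1}`,
where `z_h(i) = i + h` if `i ≤ k − h` and `z_h(i) = i + h − k` otherwise. -/
def IsCyclicShiftOn (k : ℕ) (σ : ℕ → ℕ) : Prop :=
  ∃ h < k, ∀ i ∈ Set.Icc 1 k, σ i = if i ≤ k - h then i + h else i + h - k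

lemma rot_eq (α : ℝ) (v : ℂ) : rot α v = Complex.exp (α * Complex.I) * v := by
  rw [Complex.exp_mul_I, ← Complex.ofReal_cos, ← Complex.ofReal_sin]
  apply Complex.ext <;>
    simp only [rot, Complex.mul_re, Complex.mul_im, Complex.add_re, Complex.add_im,
      Complex.ofReal_re, Complex.ofReal_im, Complex.I_re, Complex.I_im] <;> ring

lemma exp_one_const (f : ℝ → ℂ) (hf : ContinuousOn f (Set.Icc 0 1))
    (h : ∀ t ∈ Set.Icc (0:ℝ) 1, Complex.exp (f t) = 1) : f 0 = f 1 := by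
  have hpi : (2 * Real.pi : ℝ) ≠ 0 := by positivity
  have key : ∀ t ∈ Set.Icc (0:ℝ) 1, ∃ n : ℤ, f t = n * (2 * Real.pi * Complex.I) :=
    fun t ht => Complex.exp_eq_one_iff.1 (h t ht)
  have hT : IsDiscrete (Set.range ((↑) : ℤ → ℝ)) := by
    rw [isDiscrete_iff_discreteTopology]
    exact (Int.isClosedEmbedding_coe_real.isEmbedding.toHomeomorph.symm).isEmbedding.discreteTopology
  have hc : ContinuousOn (fun t => (f t).im / (2 * Real.pi)) (Set.Icc 0 1) :=
    (Complex.continuous_im.comp_continuousOn hf).div_const _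
  have := isPreconnected_Icc.constant_of_mapsTo hT hc (fun t ht => by
    obtain ⟨n, hn⟩ := key t ht
    refine ⟨n, ?_⟩
    simp only [hn]
    simp) (Set.left_mem_Icc.2 zero_le_one) (Set.right_mem_Icc.2 zero_le_one)
  obtain ⟨a, ha⟩ := key 0 (by simp)
  obtain ⟨b, hb⟩ := key 1 (by simp)
  simp only [ha, hb] at this ⊢
  simp at this
  rw [this]

lemma mem_slit {z : ℂ} (h : ‖z - 1‖ < 1) : z ∈ Complex.slitPlane := by
  have := Complex.mem_slitPlane_of_norm_lt_one h
  simpa using this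

lemma topo_one (F : ℝ × ℝ → ℂ) (hF : Continuous F) (hne : ∀ x, F x ≠ 0)
    (θ : ℝ → ℝ) (hθ : Continuous θ) (hθ0 : θ 0 = 0) (m : ℤ)
    (hθ1 : θ 1 = 2 * m * Real.pi)
    (h0 : ∀ t ∈ Set.Icc (0:ℝ) 1, ‖F (t, 0) * Complex.exp (θ t * Complex.I) - 1‖ < 1)
    (h1 : ∀ t ∈ Set.Icc (0:ℝ) 1, ‖F (t, 1) - 1‖ < 1)
    (h2 : ∀ t ∈ Set.Icc (0:ℝ) 1, ‖F (0, t) - 1‖ < 1)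
    (h3 : ∀ t ∈ Set.Icc (0:ℝ) 1, ‖F (1, t) - 1‖ < 1) : m = 0 := by
  obtain ⟨G, ⟨-, hG⟩, -⟩ := Complex.isCoveringMapOn_exp.existsUnique_continuousMap_lifts
    (⟨F, hF⟩ : C(ℝ × ℝ, ℂ)) (a₀ := (0, 0)) (e₀ := Complex.log (F (0, 0)))
    (Complex.exp_log (hne _)) (fun a => hne a)
  have hG' : ∀ x, Complex.exp (G x) = F x := fun x => congrFun hG x
  have edge : ∀ p : ℝ → ℝ × ℝ, Continuous p →
      (∀ t ∈ Set.Icc (0:ℝ) 1, ‖F (p t) - 1‖ < 1) →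
      G (p 0) - Complex.log (F (p 0)) = G (p 1) - Complex.log (F (p 1)) := by
    intro p hp h
    refine exp_one_const (fun t => G (p t) - Complex.log (F (p t))) ?_ ?_
    · refine ContinuousOn.sub (by fun_prop) ?_
      exact ContinuousOn.clog (by fun_prop) (fun t ht => mem_slit (h t ht))
    · intro t ht
      rw [Complex.exp_sub, Complex.exp_log (hne _), hG', div_self (hne _)]
  have e1 := edge (fun t => (t, 1)) (by fun_prop) h1
  have e2 := edge (fun t => (0, t)) (by fun_prop) h2
  have e3 := edge (fun t => (1, t)) (by fun_prop) h3
  have e0 := exp_one_const (fun t => G (t, 0) + θ t * Complex.I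
      - Complex.log (F (t, 0) * Complex.exp (θ t * Complex.I)))
    (by
      refine ContinuousOn.sub (by fun_prop) ?_
      exact ContinuousOn.clog (by fun_prop) (fun t ht => mem_slit (h0 t ht)))
    (by
      intro t ht
      have : F (t, 0) * Complex.exp (θ t * Complex.I) ≠ 0 :=
        mul_ne_zero (hne _) (Complex.exp_ne_zero _)
      rw [Complex.exp_sub, Complex.exp_log this, Complex.exp_add, hG', div_self this])
  have ex : Complex.exp (θ 1 * Complex.I) = 1 := by
    rw [Complex.exp_eq_one_iff]
    exact ⟨m, by rw [hθ1]; push_cast; ring⟩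
  simp only [ex, hθ0] at e0 e1 e2 e3
  simp only [Complex.ofReal_zero, zero_mul, Complex.exp_zero, mul_one, add_zero] at e0
  have : (θ 1 : ℂ) * Complex.I = 0 := by linear_combination e2 + e1 - e3 - e0
  rw [hθ1] at this
  simpa using this

lemma topo (E : ℝ → ℝ × ℝ → ℂ)
    (hE : Continuous (fun z : ℝ × (ℝ × ℝ) => E z.1 z.2))
    (φ : ℝ × ℝ → ℝ) (hφ : Continuous φ) (w : ℂ) (hw : w ≠ 0)
    (θ : ℝ → ℝ) (hθ : Continuous θ) (hθ0 : θ 0 = 0) (m : ℤ) (hm : m ≠ 0)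
    (hθ1 : θ 1 = 2 * m * Real.pi)
    (h0 : ∀ t ∈ Set.Icc (0:ℝ) 1, E 0 (t, 0) = Complex.exp (φ (t, 0) * Complex.I) *
      (Complex.exp (-(θ t * Complex.I)) * w))
    (h1 : ∀ t ∈ Set.Icc (0:ℝ) 1, E 0 (t, 1) = Complex.exp (φ (t, 1) * Complex.I) * w)
    (h2 : ∀ t ∈ Set.Icc (0:ℝ) 1, E 0 (0, t) = Complex.exp (φ (0, t) * Complex.I) * w)
    (h3 : ∀ t ∈ Set.Icc (0:ℝ) 1, E 0 (1, t) = Complex.exp (φ (1, t) * Complex.I) * w) :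
    ∃ ε ∈ Set.Ioo (0:ℝ) 1, ∃ x ∈ Set.Icc (0:ℝ) 1 ×ˢ Set.Icc (0:ℝ) 1, E ε x = 0 := by
  have hev : ∀ᶠ ε in nhds (0:ℝ), ∀ x ∈ Set.Icc (0:ℝ) 1 ×ˢ Set.Icc (0:ℝ) 1,
      ‖E ε x - E 0 x‖ < ‖w‖ := by
    apply (isCompact_Icc.prod isCompact_Icc).eventually_forall_of_forall_eventually
    intro y hy
    have hc : Continuous (fun z : ℝ × (ℝ × ℝ) => ‖E z.1 z.2 - E 0 z.2‖) := by
      have : Continuous (fun z : ℝ × (ℝ × ℝ) => E 0 z.2) :=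
        hE.comp (by fun_prop : Continuous (fun z : ℝ × (ℝ × ℝ) => ((0:ℝ), z.2)))
      exact (hE.sub this).norm
    exact hc.continuousAt.eventually_lt continuousAt_const (by simpa using hw)
  obtain ⟨ε, hε, hε0⟩ := (((hev.filter_mono nhdsWithin_le_nhds)).and
    (Ioo_mem_nhdsGT (zero_lt_one' ℝ))).exists
  refine ⟨ε, hε0, ?_⟩
  by_contra! hcon
  apply hm
  let cl : ℝ → ℝ := fun t => max 0 (min t 1)
  have hclc : Continuous cl := by fun_prop
  have hcl : ∀ t ∈ Set.Icc (0:ℝ) 1, cl t = t := by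
    intro t ht
    simp [cl, ht.1, ht.2]
  have hclm : ∀ t, cl t ∈ Set.Icc (0:ℝ) 1 := by
    intro t
    simp [cl]
  have c0 : cl 0 = 0 := hcl 0 (by simp)
  have c1 : cl 1 = 1 := hcl 1 (by simp)
  let q : ℝ × ℝ → ℝ × ℝ := fun x => (cl x.1, cl x.2)
  have hq : Continuous q := by fun_prop
  have bd : ∀ (x : ℝ × ℝ) (v : ℂ), q x = x → ‖v‖ = 1 →
      E 0 x = Complex.exp (φ x * Complex.I) * (v⁻¹ * w) →
      ‖E ε (q x) * Complex.exp (-(φ (q x) * Complex.I)) / w * v - 1‖ < 1 := by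
    intro x v hx hv hEx
    rw [hx]
    have hxm : x ∈ Set.Icc (0:ℝ) 1 ×ˢ Set.Icc (0:ℝ) 1 := by
      rw [← hx]; exact ⟨hclm _, hclm _⟩
    have hv0 : v ≠ 0 := by
      intro h; simp [h] at hv
    have e1 : E ε x * Complex.exp (-(φ x * Complex.I)) / w * v - 1
        = (E ε x - E 0 x) * Complex.exp (-(φ x * Complex.I)) / w * v := by
      rw [hEx, Complex.exp_neg]
      have := Complex.exp_ne_zero (φ x * Complex.I)
      field_simp
    have e2 : ‖Complex.exp (-(φ x * Complex.I))‖ = 1 := by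
      rw [← neg_mul, ← Complex.ofReal_neg, Complex.norm_exp_ofReal_mul_I]
    rw [e1, norm_mul, norm_div, norm_mul, e2, hv, mul_one, mul_one,
      div_lt_one (norm_pos_iff.2 hw)]
    exact hε x hxm
  refine topo_one (fun x => E ε (q x) * Complex.exp (-(φ (q x) * Complex.I)) / w) ?_ ?_
    θ hθ hθ0 m hθ1 ?_ ?_ ?_ ?_
  · have : Continuous (fun x => E ε (q x)) :=
      hE.comp (by fun_prop : Continuous (fun x : ℝ × ℝ => (ε, q x)))
    fun_prop
  · intro x
    exact div_ne_zero (mul_ne_zero (hcon _ ⟨hclm _, hclm _⟩) (Complex.exp_ne_zero _)) hw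
  · intro t ht
    refine bd (t, 0) _ (by simp [q, hcl t ht, c0]) (Complex.norm_exp_ofReal_mul_I _) ?_
    rw [h0 t ht, Complex.exp_neg]
  · intro t ht
    simpa using bd (t, 1) 1 (by simp [q, hcl t ht, c1]) (by simp) (by rw [h1 t ht]; simp)
  · intro t ht
    simpa using bd (0, t) 1 (by simp [q, hcl t ht, c0]) (by simp) (by rw [h2 t ht]; simp)
  · intro t ht
    simpa using bd (1, t) 1 (by simp [q, hcl t ht, c1]) (by simp) (by rw [h3 t ht]; simp)

lemma comb (k : ℕ) (hk : 3 ≤ k) (σ : ℕ → ℕ)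
    (hσ : Set.BijOn σ (Set.Icc 1 k) (Set.Icc 1 k)) (hn : ¬ IsCyclicShiftOn k σ) :
    ∃ a b c, 1 ≤ a ∧ a < b ∧ b < c ∧ c ≤ k ∧
      ((σ a < σ c ∧ σ c < σ b) ∨ (σ b < σ a ∧ σ a < σ c) ∨ (σ c < σ b ∧ σ b < σ a)) := by
  by_contra! H
  apply hn
  have hr : ∀ i, 1 ≤ i → i ≤ k → 1 ≤ σ i ∧ σ i ≤ k := fun i h1 h2 => hσ.mapsTo ⟨h1, h2⟩
  have hinj : ∀ i j, 1 ≤ i → i < j → j ≤ k → σ i ≠ σ j := by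
    intro i j h1 h2 h3 h
    have := hσ.injOn ⟨h1, by omega⟩ ⟨by omega, h3⟩ h
    omega
  have hr1 := hr 1 le_rfl (by omega)
  let τ : ℕ → ℕ := fun i => if σ 1 ≤ σ i then σ i - σ 1 else σ i + k - σ 1
  have hτlt : ∀ i, 1 ≤ i → i ≤ k → τ i < k := by
    intro i h1 h2
    have := hr i h1 h2
    simp only [τ]; split_ifs <;> omega
  have hmono : ∀ i, 1 ≤ i → i + 1 ≤ k → τ i < τ (i + 1) := by
    intro i h1 h2
    have a1 := hr i h1 (by omega)
    have a2 := hr (i + 1) (by omega) h2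
    have a3 := hinj i (i + 1) h1 (by omega) h2
    have a4 := hinj 1 (i + 1) le_rfl (by omega) h2
    rcases Nat.lt_or_ge 1 i with h | h
    · have a5 := hinj 1 i le_rfl h (by omega)
      have a6 := H 1 i (i + 1) le_rfl h (by omega) h2
      simp only [τ]; split_ifs <;> omega
    · have : i = 1 := by omega
      subst this
      simp only [τ]; split_ifs <;> omega
  have lo : ∀ n, n + 1 ≤ k → n ≤ τ (n + 1) := by
    intro n
    induction n with
    | zero => intro _; omega
    | succ n ih => intro h; have := ih (by omega); have := hmono (n + 1) (by omega) h; omega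
  have hi : ∀ n, n < k → τ (k - n) + n < k := by
    intro n
    induction n with
    | zero => intro _; exact hτlt _ (by omega) (by omega)
    | succ n ih =>
      intro h
      have h1 := ih (by omega)
      have h2 := hmono (k - (n + 1)) (by omega) (by omega)
      rw [show k - (n + 1) + 1 = k - n by omega] at h2
      omega
  refine ⟨σ 1 - 1, by omega, fun i hi' => ?_⟩
  have h1 : 1 ≤ i := hi'.1
  have h2 : i ≤ k := hi'.2
  have l := lo (i - 1) (by omega)
  have u := hi (k - i) (by omega)
  rw [show i - 1 + 1 = i by omega] at l
  rw [show k - (k - i) = i by omega] at u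
  have := hr i h1 h2
  simp only [τ] at l u
  split_ifs at l u ⊢ <;> omega

lemma cyc (γ : ℝ → ℂ) (θ : ℝ → ℝ) (hnc : γ 1 ≠ γ 0) (hθ0 : θ 0 = 0)
    (m : ℤ) (hturn : θ 1 = 2 * m * Real.pi) (k : ℕ) (σ : ℕ → ℕ)
    (hσ : Set.BijOn σ (Set.Icc 1 k) (Set.Icc 1 k)) (hc : IsCyclicShiftOn k σ)
    (c : ℕ → ℝ) (c0 : c 0 = 0) (ck : c k = 1) : rearrangedEnd k γ θ σ c ≠ 0 := by
  obtain ⟨h, hk, hs⟩ := hc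
  have ex : Complex.exp (θ 1 * Complex.I) = 1 := by
    rw [Complex.exp_eq_one_iff]
    exact ⟨m, by rw [hturn]; push_cast; ring⟩
  have pre : ∀ n, n ≤ k → (∑ j ∈ Finset.Icc 1 n, (θ (c (σ j)) - θ (c (σ j - 1))))
      = if n ≤ k - h then θ (c (n + h)) - θ (c h) else θ 1 - θ (c h) + θ (c (n + h - k)) := by
    intro n
    induction n with
    | zero => intro _; simp
    | succ n ih =>
      intro hn
      rw [Finset.sum_Icc_succ_top (by omega), ih (by omega), hs (n + 1) ⟨by omega, hn⟩]
      by_cases h1 : n + 1 ≤ k - h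
      · rw [if_pos (by omega), if_pos h1, if_pos h1, show n + 1 + h - 1 = n + h by omega]
        ring
      · rw [if_neg h1, if_neg h1]
        by_cases h2 : n ≤ k - h
        · rw [if_pos h2, show n + 1 + h - k - 1 = 0 by omega, show n + h = k by omega, c0, ck, hθ0]
          ring
        · rw [if_neg h2, show n + 1 + h - k - 1 = n + h - k by omega]
          ring
  have ter : ∀ i ∈ Finset.Icc 1 k,
      rot ((∑ j ∈ Finset.Icc 1 (i - 1), (θ (c (σ j)) - θ (c (σ j - 1)))) - θ (c (σ i - 1)))
        (γ (c (σ i)) - γ (c (σ i - 1)))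
      = Complex.exp (-(θ (c h) * Complex.I)) * (γ (c (σ i)) - γ (c (σ i - 1))) := by
    intro i hi
    rw [Finset.mem_Icc] at hi
    rw [rot_eq, pre (i - 1) (by omega)]
    congr 1
    have hsi := hs i hi
    by_cases h1 : i ≤ k - h
    · rw [if_pos (by omega), show σ i - 1 = i - 1 + h by rw [hsi, if_pos h1]; omega]
      congr 1; push_cast; ring
    · rw [if_neg h1] at hsi
      by_cases h2 : i - 1 ≤ k - h
      · rw [if_pos h2, show σ i - 1 = 0 by omega, show i - 1 + h = k by omega, c0, ck, hθ0]
        rw [show ((θ 1 - θ (c h) - 0 : ℝ) : ℂ) * Complex.I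
          = θ 1 * Complex.I + -(θ (c h) * Complex.I) by push_cast; ring, Complex.exp_add, ex,
          one_mul]
      · rw [if_neg h2, show σ i - 1 = i - 1 + h - k by omega]
        rw [show ((θ 1 - θ (c h) + θ (c (i - 1 + h - k)) - θ (c (i - 1 + h - k)) : ℝ) : ℂ)
            * Complex.I
          = θ 1 * Complex.I + -(θ (c h) * Complex.I) by push_cast; ring, Complex.exp_add, ex,
          one_mul]
  have tel : ∀ n, ∑ i ∈ Finset.Icc 1 n, (γ (c i) - γ (c (i - 1))) = γ (c n) - γ (c 0) := by
    intro n
    induction n with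
    | zero => simp
    | succ n ih => rw [Finset.sum_Icc_succ_top (by omega), ih, Nat.add_sub_cancel]; ring
  have re : ∑ i ∈ Finset.Icc 1 k, (γ (c (σ i)) - γ (c (σ i - 1)))
      = ∑ i ∈ Finset.Icc 1 k, (γ (c i) - γ (c (i - 1))) := by
    refine Finset.sum_nbij σ ?_ ?_ ?_ (fun _ _ => rfl)
    · intro i hi
      have := hσ.mapsTo (Finset.mem_Icc.1 hi)
      exact Finset.mem_Icc.2 this
    · simpa using hσ.injOn
    · simpa using hσ.surjOn
  rw [rearrangedEnd, Finset.sum_congr rfl ter, ← Finset.mul_sum, re, tel, c0, ck]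
  exact mul_ne_zero (Complex.exp_ne_zero _) (sub_ne_zero.2 hnc)

lemma three (γ : ℝ → ℂ) (θ : ℝ → ℝ) (k : ℕ) (σ : ℕ → ℕ) (c : ℕ → ℝ) (i₁ i₂ i₃ : ℕ)
    (h1 : 1 ≤ i₁) (h12 : i₁ < i₂) (h23 : i₂ < i₃) (h3 : i₃ ≤ k)
    (hd : ∀ i, 1 ≤ i → i ≤ k → i ≠ i₁ → i ≠ i₂ → i ≠ i₃ → c (σ i) = c (σ i - 1)) :
    rearrangedEnd k γ θ σ c =
      rot (-θ (c (σ i₁ - 1))) (γ (c (σ i₁)) - γ (c (σ i₁ - 1)))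
      + rot ((θ (c (σ i₁)) - θ (c (σ i₁ - 1))) - θ (c (σ i₂ - 1)))
          (γ (c (σ i₂)) - γ (c (σ i₂ - 1)))
      + rot ((θ (c (σ i₁)) - θ (c (σ i₁ - 1))) + (θ (c (σ i₂)) - θ (c (σ i₂ - 1)))
          - θ (c (σ i₃ - 1))) (γ (c (σ i₃)) - γ (c (σ i₃ - 1))) := by
  have s1 : ∑ j ∈ Finset.Icc 1 (i₁ - 1), (θ (c (σ j)) - θ (c (σ j - 1))) = 0 := by
    refine Finset.sum_eq_zero fun j hj => ?_
    rw [Finset.mem_Icc] at hj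
    rw [hd j (by omega) (by omega) (by omega) (by omega) (by omega), sub_self]
  have s2 : ∑ j ∈ Finset.Icc 1 (i₂ - 1), (θ (c (σ j)) - θ (c (σ j - 1)))
      = θ (c (σ i₁)) - θ (c (σ i₁ - 1)) := by
    refine Finset.sum_eq_single i₁ (fun j hj hne => ?_) (fun h => ?_)
    · rw [Finset.mem_Icc] at hj
      rw [hd j (by omega) (by omega) (by omega) (by omega) (by omega), sub_self]
    · exact absurd (Finset.mem_Icc.2 ⟨by omega, by omega⟩) h
  have s3 : ∑ j ∈ Finset.Icc 1 (i₃ - 1), (θ (c (σ j)) - θ (c (σ j - 1)))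
      = (θ (c (σ i₁)) - θ (c (σ i₁ - 1))) + (θ (c (σ i₂)) - θ (c (σ i₂ - 1))) := by
    rw [← Finset.sum_pair (f := fun j => θ (c (σ j)) - θ (c (σ j - 1))) (show i₁ ≠ i₂ by omega)]
    symm
    refine Finset.sum_subset ?_ (fun j hj hne => ?_)
    · intro j hj
      simp only [Finset.mem_insert, Finset.mem_singleton] at hj
      rw [Finset.mem_Icc]; omega
    · rw [Finset.mem_Icc] at hj
      simp only [Finset.mem_insert, Finset.mem_singleton] at hne
      rw [hd j (by omega) (by omega) (by omega) (by omega) (by omega), sub_self]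
  rw [rearrangedEnd, ← Finset.sum_subset (s₁ := {i₁, i₂, i₃})]
  · rw [Finset.sum_insert (by simp; omega), Finset.sum_pair (by omega), s1, s2, s3, zero_sub,
      add_assoc]
  · intro j hj
    simp only [Finset.mem_insert, Finset.mem_singleton] at hj
    rw [Finset.mem_Icc]; omega
  · intro j hj hne
    rw [Finset.mem_Icc] at hj
    simp only [Finset.mem_insert, Finset.mem_singleton] at hne
    rw [hd j (by omega) (by omega) (by omega) (by omega) (by omega), sub_self, rot_eq, mul_zero]

noncomputable def baseCut (p q r : ℕ) (x : ℝ × ℝ) (n : ℕ) : ℝ :=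
  if n < p then 0 else if n < q then x.1 * x.2 else if n < r then x.1 else 1

noncomputable def pcut (p q r k : ℕ) (ε : ℝ) (x : ℝ × ℝ) (n : ℕ) : ℝ :=
  (1 - ε) * baseCut p q r x n + ε * ((n : ℝ) / k)

lemma baseCut_mono (p q r : ℕ) (x : ℝ × ℝ)
    (hx : x ∈ Set.Icc (0:ℝ) 1 ×ˢ Set.Icc (0:ℝ) 1) (n : ℕ) :
    baseCut p q r x n ≤ baseCut p q r x (n + 1) := by
  obtain ⟨⟨h1, h2⟩, h3, h4⟩ := hx
  have h5 : 0 ≤ x.1 * x.2 := mul_nonneg h1 h3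
  have h6 : x.1 * x.2 ≤ x.1 := mul_le_of_le_one_right h1 h4
  unfold baseCut
  split_ifs <;> first | linarith | omega

lemma pcut_zero (p q r k : ℕ) (x : ℝ × ℝ) : pcut p q r k 0 x = baseCut p q r x := by
  funext n; simp [pcut]

/-- The model endpoint map for the order (first, third, second). -/
noncomputable def model (γ : ℝ → ℂ) (θ : ℝ → ℝ) (x : ℝ × ℝ) : ℂ :=
  γ (x.1 * x.2) + Complex.exp (θ (x.1 * x.2) * Complex.I - θ x.1 * Complex.I) * (γ 1 - γ x.1)
    + Complex.exp (-(θ x.1 * Complex.I)) * (γ x.1 - γ (x.1 * x.2))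

lemma core_phi (γ : ℝ → ℂ) (θ : ℝ → ℝ) (hγ : Continuous γ) (hθ : Continuous θ)
    (hγ0 : γ 0 = 0) (hγ1 : γ 1 ≠ 0) (hθ0 : θ 0 = 0) (m : ℤ) (hm : m ≠ 0)
    (hθ1 : θ 1 = 2 * m * Real.pi) (k : ℕ) (hk : 3 ≤ k) (σ : ℕ → ℕ)
    (p q r : ℕ) (hp : 1 ≤ p) (hr : r ≤ k)
    (φ : ℝ × ℝ → ℝ) (hφ : Continuous φ)
    (hE : ∀ x, rearrangedEnd k γ θ σ (baseCut p q r x)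
      = Complex.exp (φ x * Complex.I) * model γ θ x) (hpq : p < q) (hqr : q < r) :
    ∃ c : ℕ → ℝ, c 0 = 0 ∧ c k = 1 ∧ (∀ i < k, c i < c (i + 1)) ∧
      rearrangedEnd k γ θ σ c = 0 := by
  have ex : Complex.exp (θ 1 * Complex.I) = 1 := by
    rw [Complex.exp_eq_one_iff]
    exact ⟨m, by rw [hθ1]; push_cast; ring⟩
  have hk0 : (0:ℝ) < k := by exact_mod_cast (by omega : 0 < k)
  have hcut : ∀ n, Continuous (fun z : ℝ × (ℝ × ℝ) => pcut p q r k z.1 z.2 n) := by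
    intro n
    unfold pcut baseCut
    split_ifs <;> fun_prop
  obtain ⟨ε, hε, x, hx, he⟩ := topo
    (fun ε x => rearrangedEnd k γ θ σ (pcut p q r k ε x))
    (by
      simp only [rearrangedEnd, rot_eq]
      refine continuous_finsetSum _ fun i _ => ?_
      have a1 := hcut (σ i)
      have a2 := hcut (σ i - 1)
      have a3 : Continuous (fun z : ℝ × (ℝ × ℝ) => ∑ j ∈ Finset.Icc 1 (i - 1),
          (θ (pcut p q r k z.1 z.2 (σ j)) - θ (pcut p q r k z.1 z.2 (σ j - 1)))) := by
        refine continuous_finsetSum _ fun j _ => ?_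
        exact (hθ.comp (hcut _)).sub (hθ.comp (hcut _))
      refine Continuous.mul ?_ ((hγ.comp a1).sub (hγ.comp a2))
      exact Complex.continuous_exp.comp
        ((Complex.continuous_ofReal.comp (a3.sub (hθ.comp a2))).mul continuous_const))
    φ hφ (γ 1) hγ1 θ hθ hθ0 m hm hθ1
    (by
      intro t _
      simp only [pcut_zero, hE, model, mul_zero, hγ0, hθ0, Complex.ofReal_zero, zero_mul, zero_sub]
      ring)
    (by
      intro t _
      simp only [pcut_zero, hE, model, mul_one, sub_self, Complex.exp_zero]
      ring)
    (by
      intro t _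
      simp only [pcut_zero, hE, model, zero_mul, hγ0, hθ0, Complex.ofReal_zero, sub_self,
        Complex.exp_zero]
      ring)
    (by
      intro t _
      simp only [pcut_zero, hE, model, one_mul, sub_self, Complex.exp_neg, ex]
      ring)
  refine ⟨pcut p q r k ε x, ?_, ?_, ?_, he⟩
  · simp [pcut, baseCut, show 0 < p by omega]
  · simp only [pcut, baseCut]
    rw [if_neg (by omega), if_neg (by omega), if_neg (by omega), div_self hk0.ne']
    ring
  · intro i _
    have h1 := baseCut_mono p q r x hx i
    have h2 : (i : ℝ) / k < ((i + 1 : ℕ) : ℝ) / k := by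
      apply div_lt_div_of_pos_right _ hk0
      push_cast; linarith
    have h3 := mul_le_mul_of_nonneg_left h1 (sub_nonneg.2 hε.2.le)
    have h4 := mul_lt_mul_of_pos_left h2 hε.1
    simp only [pcut]
    linarith

lemma core (γ : ℝ → ℂ) (θ : ℝ → ℝ) (hγ : Continuous γ) (hθ : Continuous θ)
    (hγ0 : γ 0 = 0) (hγ1 : γ 1 ≠ 0) (hθ0 : θ 0 = 0) (m : ℤ) (hm : m ≠ 0)
    (hθ1 : θ 1 = 2 * m * Real.pi) (k : ℕ) (hk : 3 ≤ k) (σ : ℕ → ℕ)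
    (hσ : Set.BijOn σ (Set.Icc 1 k) (Set.Icc 1 k)) (hn : ¬ IsCyclicShiftOn k σ) :
    ∃ c : ℕ → ℝ, c 0 = 0 ∧ c k = 1 ∧ (∀ i < k, c i < c (i + 1)) ∧
      rearrangedEnd k γ θ σ c = 0 := by
  have ex : Complex.exp (θ 1 * Complex.I) = 1 := by
    rw [Complex.exp_eq_one_iff]
    exact ⟨m, by rw [hθ1]; push_cast; ring⟩
  obtain ⟨a, b, c, ha, hab, hbc, hck, hpat⟩ := comb k hk σ hσ hn
  have hr : ∀ i, 1 ≤ i → i ≤ k → 1 ≤ σ i ∧ σ i ≤ k := fun i h1 h2 => hσ.mapsTo ⟨h1, h2⟩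
  have ra := hr a ha (by omega)
  have rb := hr b (by omega) (by omega)
  have rc := hr c (by omega) hck
  have hinj : ∀ i j, 1 ≤ i → i ≤ k → 1 ≤ j → j ≤ k → i ≠ j → σ i ≠ σ j := by
    intro i j h1 h2 h3 h4 h h'
    exact h (hσ.injOn ⟨h1, h2⟩ ⟨h3, h4⟩ h')
  have v : ∀ p q r : ℕ, 1 ≤ p → p < q → q < r → ∀ x : ℝ × ℝ,
      baseCut p q r x (p - 1) = 0 ∧ baseCut p q r x p = x.1 * x.2 ∧
      baseCut p q r x (q - 1) = x.1 * x.2 ∧ baseCut p q r x q = x.1 ∧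
      baseCut p q r x (r - 1) = x.1 ∧ baseCut p q r x r = 1 := by
    intro p q r h1 h2 h3 x
    unfold baseCut
    refine ⟨?_, ?_, ?_, ?_, ?_, ?_⟩ <;> split_ifs <;> first | rfl | omega
  have deg : ∀ p q r : ℕ, ∀ x : ℝ × ℝ, ∀ n, n ≠ p → n ≠ q → n ≠ r →
      baseCut p q r x n = baseCut p q r x (n - 1) := by
    intro p q r x n h1 h2 h3
    unfold baseCut
    split_ifs <;> first | rfl | omega
  have eX := fun t : ℝ => Complex.exp_ne_zero (θ t * Complex.I)
  rcases hpat with ⟨h1, h2⟩ | ⟨h1, h2⟩ | ⟨h1, h2⟩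
  · refine core_phi γ θ hγ hθ hγ0 hγ1 hθ0 m hm hθ1 k hk σ (σ a) (σ c) (σ b) ra.1 rb.2
      (fun _ => 0) continuous_const (fun x => ?_) h1 h2
    obtain ⟨v1, v2, v3, v4, v5, v6⟩ := v (σ a) (σ c) (σ b) ra.1 h1 h2 x
    rw [three γ θ k σ _ a b c ha hab hbc hck (fun i i1 i2 i3 i4 i5 =>
      deg _ _ _ x _ (hinj i a i1 i2 (by omega) (by omega) i3)
        (hinj i c i1 i2 (by omega) (by omega) i5) (hinj i b i1 i2 (by omega) (by omega) i4))]
    simp only [v1, v2, v3, v4, v5, v6, rot_eq, model, hγ0, hθ0]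
    push_cast
    simp only [sub_mul, add_mul, neg_mul, Complex.exp_add, Complex.exp_sub, Complex.exp_neg, ex,
      zero_mul, Complex.exp_zero]
    have := eX x.1
    have := eX (x.1 * x.2)
    field_simp
    try ring
  · refine core_phi γ θ hγ hθ hγ0 hγ1 hθ0 m hm hθ1 k hk σ (σ b) (σ a) (σ c) rb.1 rc.2
      (fun x => θ x.1 - θ (x.1 * x.2)) (by fun_prop) (fun x => ?_) h1 h2
    obtain ⟨v1, v2, v3, v4, v5, v6⟩ := v (σ b) (σ a) (σ c) rb.1 h1 h2 x
    rw [three γ θ k σ _ a b c ha hab hbc hck (fun i i1 i2 i3 i4 i5 =>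
      deg _ _ _ x _ (hinj i b i1 i2 (by omega) (by omega) i4)
        (hinj i a i1 i2 (by omega) (by omega) i3) (hinj i c i1 i2 (by omega) (by omega) i5))]
    simp only [v1, v2, v3, v4, v5, v6, rot_eq, model, hγ0, hθ0]
    push_cast
    simp only [sub_mul, add_mul, neg_mul, Complex.exp_add, Complex.exp_sub, Complex.exp_neg, ex,
      zero_mul, Complex.exp_zero]
    have := eX x.1
    have := eX (x.1 * x.2)
    field_simp
    try ring
  · refine core_phi γ θ hγ hθ hγ0 hγ1 hθ0 m hm hθ1 k hk σ (σ c) (σ b) (σ a) rc.1 ra.2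
      (fun x => - θ (x.1 * x.2)) (by fun_prop) (fun x => ?_) h1 h2
    obtain ⟨v1, v2, v3, v4, v5, v6⟩ := v (σ c) (σ b) (σ a) rc.1 h1 h2 x
    rw [three γ θ k σ _ a b c ha hab hbc hck (fun i i1 i2 i3 i4 i5 =>
      deg _ _ _ x _ (hinj i c i1 i2 (by omega) (by omega) i5)
        (hinj i b i1 i2 (by omega) (by omega) i4) (hinj i a i1 i2 (by omega) (by omega) i3))]
    simp only [v1, v2, v3, v4, v5, v6, rot_eq, model, hγ0, hθ0]
    push_cast
    simp only [sub_mul, add_mul, neg_mul, Complex.exp_add, Complex.exp_sub, Complex.exp_neg, ex,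
      zero_mul, Complex.exp_zero]
    have := eX x.1
    have := eX (x.1 * x.2)
    field_simp
    try ring

/-- For a non-closed `C¹` constant-speed curve `γ` with
`γ(0) = 0`, turning angle `θ` with `θ(0) = 0` and `θ(1) − θ(0) = 2mπ`, `m ≠ 0`,
`k ≥ 3` and a permutation `σ` of `{1,…,k}`: there exist cuts `C` in the interior
of `D_k` (`0 < c₁ < … < c_{k−1} < 1`, so no arc degenerates) with `e_σ(C) = 0`,
i.e. the rearranged curve `r_{σ,C}` is a closed `C¹` curve, iff `σ` is not a
cyclic shift. -/
theorem properly_rearrangeable_iff_not_cyclic_shift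
    (γ : ℝ → ℂ) (θ : ℝ → ℝ) (cs : ℝ) (hcs : 0 < cs)
    (hγ0 : γ 0 = 0) (hnc : γ 1 ≠ γ 0) (hθ0 : θ 0 = 0)
    (hθ : ContinuousOn θ (Set.Icc 0 1))
    (hderiv : ∀ s ∈ Set.Icc (0:ℝ) 1,
      HasDerivAt γ (cs • (⟨Real.cos (θ s), Real.sin (θ s)⟩ : ℂ)) s)
    (m : ℤ) (hm : m ≠ 0) (hturn : θ 1 - θ 0 = 2 * m * Real.pi)
    (k : ℕ) (hk : 3 ≤ k) (σ : ℕ → ℕ)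
    (hσ : Set.BijOn σ (Set.Icc 1 k) (Set.Icc 1 k)) :
    (∃ c : ℕ → ℝ, IsCuts k c ∧ (∀ i < k, c i < c (i + 1)) ∧
      rearrangedEnd k γ θ σ c = 0) ↔
    ¬ IsCyclicShiftOn k σ := by
  have hθ1 : θ 1 = 2 * m * Real.pi := by rw [← hturn, hθ0, sub_zero]
  constructor
  · rintro ⟨c, hc, -, he⟩ hcyc
    exact cyc γ θ hnc hθ0 m hθ1 k σ hσ hcyc c hc.1 hc.2.1 he
  · intro hn
    have hγc : ContinuousOn γ (Set.Icc 0 1) := fun s hs =>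
      (hderiv s hs).continuousAt.continuousWithinAt
    let g : ℝ → ℂ := Set.IccExtend (zero_le_one' ℝ) ((Set.Icc (0:ℝ) 1).domRestrict γ)
    let T : ℝ → ℝ := Set.IccExtend (zero_le_one' ℝ) ((Set.Icc (0:ℝ) 1).domRestrict θ)
    have hg : Continuous g := hγc.domRestrict.comp continuous_projIcc
    have hT : Continuous T := hθ.domRestrict.comp continuous_projIcc
    have gE : ∀ s ∈ Set.Icc (0:ℝ) 1, g s = γ s := fun s hs => by
      simp only [g]; rw [Set.IccExtend_of_mem _ _ hs]; rfl
    have TE : ∀ s ∈ Set.Icc (0:ℝ) 1, T s = θ s := fun s hs => by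
      simp only [T]; rw [Set.IccExtend_of_mem _ _ hs]; rfl
    have z0 : (0:ℝ) ∈ Set.Icc (0:ℝ) 1 := by simp
    have z1 : (1:ℝ) ∈ Set.Icc (0:ℝ) 1 := by simp
    obtain ⟨c, c0, ck, hlt, he⟩ := core g T hg hT (by rw [gE 0 z0, hγ0])
      (by rw [gE 1 z1, ← hγ0]; exact hnc) (by rw [TE 0 z0, hθ0]) m hm (by rw [TE 1 z1, hθ1])
      k hk σ hσ hn
    refine ⟨c, ⟨c0, ck, fun i hi => (hlt i hi).le⟩, hlt, ?_⟩
    have hlo : ∀ n, n ≤ k → 0 ≤ c n := by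
      intro n
      induction n with
      | zero => intro _; rw [c0]
      | succ n ih => intro h; exact (ih (by omega)).trans (hlt n (by omega)).le
    have hup : ∀ n, n ≤ k → c (k - n) ≤ 1 := by
      intro n
      induction n with
      | zero => intro _; rw [Nat.sub_zero, ck]
      | succ n ih =>
        intro h
        have := hlt (k - (n + 1)) (by omega)
        rw [show k - (n + 1) + 1 = k - n by omega] at this
        exact this.le.trans (ih (by omega))
    have hcm : ∀ n, n ≤ k → c n ∈ Set.Icc (0:ℝ) 1 := by
      intro n hn
      refine ⟨hlo n hn, ?_⟩
      have := hup (k - n) (by omega)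
      rwa [show k - (k - n) = n by omega] at this
    have hs1 : ∀ i, 1 ≤ i → i ≤ k → σ i ≤ k := fun i h1 h2 => (hσ.mapsTo ⟨h1, h2⟩).2
    rw [← he, rearrangedEnd, rearrangedEnd]
    refine Finset.sum_congr rfl fun i hi => ?_
    rw [Finset.mem_Icc] at hi
    have hsi := hs1 i hi.1 hi.2
    rw [gE _ (hcm _ hsi), gE _ (hcm (σ i - 1) (by omega)), TE _ (hcm (σ i - 1) (by omega))]
    congr 2
    refine Finset.sum_congr rfl fun j hj => ?_
    rw [Finset.mem_Icc] at hj
    have hsj := hs1 j hj.1 (by omega)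
    rw [TE _ (hcm _ hsj), TE _ (hcm (σ j - 1) (by omega))]
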